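/- arXiv:1311.4833 — 4 statements merged into one kernel-verified Lean document; each statement's English description precedes it below -/
import Mathlib

section
/- Let X be a measurable space, let H be a measurable space of measurable voters h : X → [-1,1] (i.e., a measurable evaluation map (h,x) ↦ h(x) with values in [-1,1]), let ρ be a probability measure on H, let P_T be a probability measure on X × {-1,+1} with marginal D_T on X, and let l : X → {-1,+1} be a measurable labeling function. If the l-margin μ_l := E_{h∼ρ} E_{x∼D_T}[ l(x) h(x) ] is strictly positive, then the risk of the ρ-weighted majority vote satisfies R_{P_T}(B_ρ) ≤ 1 − μ_l² / ( E_{(h,h')∼ρ⊗ρ} E_{x∼D_T}[ h(x) h'(x) ] ) + (1/2) E_{(x,y)∼P_T}[ |y − l(x)| ]. -/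
open MeasureTheory

/-- sign function: 1 if t > 0, -1 otherwise. -/
noncomputable def sgn (t : ℝ) : ℝ := if 0 < t then 1 else -1

theorem measurable_sgn : Measurable sgn :=
  Measurable.ite measurableSet_Ioi measurable_const measurable_const

theorem sgn_eq_one_or_neg_one (t : ℝ) : sgn t = 1 ∨ sgn t = -1 := by
  unfold sgn
  split_ifs <;> simp

/-- A pointwise second-moment bound on the margin `s * g` of the vote `g` at the label `s`. -/
theorem two_mul_margin_le {s : ℝ} (hs : s = 1 ∨ s = -1) (g : ℝ) {t : ℝ} (ht : 0 ≤ t) :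
    2 * t * (s * g) ≤ t ^ 2 * (g * g) + (1 + s * sgn g) / 2 := by
  unfold sgn
  rcases hs with rfl | rfl <;> split_ifs with hg
  · nlinarith [sq_nonneg (t * g - 1)]
  · nlinarith [sq_nonneg (t * g), mul_nonneg ht (neg_nonneg.2 (not_lt.1 hg))]
  · nlinarith [sq_nonneg (t * g), mul_nonneg ht hg.le]
  · nlinarith [sq_nonneg (t * g + 1)]

/-- Optimising over `t` in the quadratic bound `2 t m ≤ t² q + e`. -/
theorem sq_div_le_of_forall_two_mul_le {m q e : ℝ} (hm : 0 < m) (hq : 0 ≤ q) (he : e ≤ 1)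
    (h : ∀ t : ℝ, 0 ≤ t → 2 * t * m ≤ t ^ 2 * q + e) : m ^ 2 / q ≤ e := by
  rcases hq.eq_or_lt with rfl | hq
  · have h1 := h m⁻¹ (by positivity)
    rw [mul_assoc, inv_mul_cancel₀ hm.ne'] at h1
    linarith
  · have h1 := h (m / q) (by positivity)
    have h2 : 2 * (m / q) * m = 2 * (m ^ 2 / q) := by ring
    have h3 : (m / q) ^ 2 * q = m ^ 2 / q := by field_simp
    linarith

theorem integrable_of_abs_le {α : Type*} [MeasurableSpace α] {P : Measure α} [IsFiniteMeasure P]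
    {f : α → ℝ} (hf : Measurable f) {C : ℝ} (hC : ∀ᵐ x ∂P, |f x| ≤ C) : Integrable f P :=
  Integrable.of_bound hf.aestronglyMeasurable C hC

/-- The C-bound for the majority vote of voters with values in `[-1, 1]` against a labelling
function. -/
theorem sq_margin_div_le
    {X H : Type*} [MeasurableSpace X] [MeasurableSpace H] {ev : H → X → ℝ}
    (hev : Measurable (fun p : H × X => ev p.1 p.2)) (hbd : ∀ h x, |ev h x| ≤ 1)
    (ρ : Measure H) [IsProbabilityMeasure ρ] (D : Measure X) [IsProbabilityMeasure D]
    {l : X → ℝ} (hl : Measurable l) (hlval : ∀ x, l x = 1 ∨ l x = -1)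
    (hpos : 0 < ∫ h, ∫ x, l x * ev h x ∂D ∂ρ) :
    (∫ h, ∫ x, l x * ev h x ∂D ∂ρ) ^ 2 /
        (∫ hh : H × H, ∫ x, ev hh.1 x * ev hh.2 x ∂D ∂(ρ.prod ρ))
      ≤ (1 + ∫ x, l x * sgn (∫ h, ev h x ∂ρ) ∂D) / 2 := by
  have hlabs (x) : |l x| = 1 := by rcases hlval x with h | h <;> simp [h]
  have hsabs (t) : |sgn t| = 1 := by rcases sgn_eq_one_or_neg_one t with h | h <;> simp [h]
  have hmargin : ∫ h, ∫ x, l x * ev h x ∂D ∂ρ = ∫ x, l x * ∫ h, ev h x ∂ρ ∂D := by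
    rw [integral_integral_swap]
    · simp only [integral_const_mul]
    · refine integrable_of_abs_le (C := 1) ((hl.comp measurable_snd).mul hev) (.of_forall ?_)
      intro p
      simpa [Function.uncurry, abs_mul, hlabs] using hbd p.1 p.2
  have hsecond : ∫ hh : H × H, ∫ x, ev hh.1 x * ev hh.2 x ∂D ∂(ρ.prod ρ) =
      ∫ x, (∫ h, ev h x ∂ρ) * (∫ h, ev h x ∂ρ) ∂D := by
    rw [integral_integral_swap]
    · refine integral_congr_ae (.of_forall fun x => ?_)
      exact integral_prod_mul (fun h => ev h x) (fun h => ev h x)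
    · refine integrable_of_abs_le (C := 1) ?_ (.of_forall ?_)
      · exact (hev.comp ((measurable_fst.comp measurable_fst).prodMk measurable_snd)).mul
          (hev.comp ((measurable_snd.comp measurable_fst).prodMk measurable_snd))
      · intro p
        simpa [Function.uncurry, abs_mul] using
          mul_le_one₀ (hbd p.1.1 p.2) (abs_nonneg _) (hbd p.1.2 p.2)
  rw [hmargin] at hpos ⊢
  rw [hsecond]
  have hg : Measurable fun x => ∫ h, ev h x ∂ρ :=
    (hev.stronglyMeasurable.integral_prod_left' (μ := ρ)).measurable
  have hgabs (x) : |∫ h, ev h x ∂ρ| ≤ 1 := by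
    simpa using norm_integral_le_of_norm_le_const (μ := ρ) (f := fun h => ev h x) (C := 1)
      (.of_forall fun h => hbd h x)
  obtain ⟨g, hgdef⟩ : ∃ g : X → ℝ, ∀ x, ∫ h, ev h x ∂ρ = g x := ⟨_, fun _ => rfl⟩
  simp only [hgdef] at hpos hg hgabs ⊢
  have hi1 : Integrable (fun x => l x * g x) D :=
    integrable_of_abs_le (C := 1) (hl.mul hg)
      (.of_forall fun x => by simpa [abs_mul, hlabs] using hgabs x)
  have hi2 : Integrable (fun x => g x * g x) D :=
    integrable_of_abs_le (C := 1) (hg.mul hg)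
      (.of_forall fun x => by
        simpa only [abs_mul] using mul_le_one₀ (hgabs x) (abs_nonneg _) (hgabs x))
  have hi3 : Integrable (fun x => l x * sgn (g x)) D :=
    integrable_of_abs_le (C := 1) (hl.mul (measurable_sgn.comp hg))
      (.of_forall fun x => by simp [abs_mul, hlabs, hsabs])
  refine sq_div_le_of_forall_two_mul_le hpos (integral_nonneg fun x => mul_self_nonneg _) ?_ ?_
  · have : ∫ x, l x * sgn (g x) ∂D ≤ ∫ _, (1 : ℝ) ∂D :=
      integral_mono hi3 (integrable_const 1) fun x =>
        (le_abs_self _).trans (by simp [abs_mul, hlabs, hsabs])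
    simp only [integral_const, probReal_univ, one_smul] at this
    linarith
  · intro t ht
    have hi4 := ((integrable_const (1 : ℝ)).add hi3).div_const 2
    have := integral_mono (hi1.const_mul (2 * t)) ((hi2.const_mul (t ^ 2)).add hi4)
      fun x => two_mul_margin_le (hlval x) (g x) ht
    rw [integral_add' (hi2.const_mul _) hi4, integral_const_mul, integral_const_mul,
      integral_div, integral_add' (integrable_const 1) hi3] at this
    simpa using this

/-- The C-bound suitable to domain adaptation with a label transfer function
(Corollary of Section 3). -/
theorem da_c_bound
    {X H : Type*} [MeasurableSpace X] [MeasurableSpace H]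
    (ev : H → X → ℝ)
    (hev : Measurable (fun p : H × X => ev p.1 p.2))
    (hbd : ∀ h x, ev h x ∈ Set.Icc (-1 : ℝ) 1)
    (ρ : Measure H) [IsProbabilityMeasure ρ]
    (PT : Measure (X × ℝ)) [IsProbabilityMeasure PT]
    (hlab : ∀ᵐ p ∂PT, p.2 = 1 ∨ p.2 = -1)
    (DT : Measure X) (hDT : DT = PT.map Prod.fst)
    (l : X → ℝ) (hl : Measurable l) (hlval : ∀ x, l x = 1 ∨ l x = -1)
    (μl : ℝ) (hμl : μl = ∫ h, ∫ x, l x * ev h x ∂DT ∂ρ)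
    (hpos : 0 < μl) :
    (1 / 2 : ℝ) * (1 - ∫ p, p.2 * sgn (∫ h, ev h p.1 ∂ρ) ∂PT)
      ≤ 1 - μl ^ 2 /
            (∫ hh : H × H, ∫ x, ev hh.1 x * ev hh.2 x ∂DT ∂(ρ.prod ρ))
        + (1 / 2 : ℝ) * ∫ p, |p.2 - l p.1| ∂PT := by
  have : IsProbabilityMeasure DT :=
    hDT ▸ Measure.isProbabilityMeasure_map measurable_fst.aemeasurable
  subst hμl
  have hbound := sq_margin_div_le hev (fun h x => abs_le.2 (hbd h x)) ρ DT hl hlval hpos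
  have hB : Measurable fun x => sgn (∫ h, ev h x ∂ρ) :=
    measurable_sgn.comp (hev.stronglyMeasurable.integral_prod_left' (μ := ρ)).measurable
  have hmap : ∫ x, l x * sgn (∫ h, ev h x ∂ρ) ∂DT =
      ∫ p, l p.1 * sgn (∫ h, ev h p.1 ∂ρ) ∂PT := by
    rw [hDT]
    exact integral_map measurable_fst.aemeasurable (hl.mul hB).aestronglyMeasurable
  have hBval (x) := sgn_eq_one_or_neg_one (∫ h, ev h x ∂ρ)
  have hi1 : Integrable (fun p : X × ℝ => l p.1 * sgn (∫ h, ev h p.1 ∂ρ)) PT := by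
    refine integrable_of_abs_le (C := 1) ((hl.mul hB).comp measurable_fst) (.of_forall ?_)
    intro p
    rcases hlval p.1 with h | h <;> rcases hBval p.1 with h' | h' <;> simp [h, h']
  have hi2 : Integrable (fun p : X × ℝ => p.2 * sgn (∫ h, ev h p.1 ∂ρ)) PT := by
    refine integrable_of_abs_le (C := 1) (measurable_snd.mul (hB.comp measurable_fst)) ?_
    filter_upwards [hlab] with p hp
    rcases hp with h | h <;> rcases hBval p.1 with h' | h' <;> simp [h, h']
  have hi3 : Integrable (fun p : X × ℝ => |p.2 - l p.1|) PT := by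
    refine integrable_of_abs_le (C := 2)
      (measurable_snd.sub (hl.comp measurable_fst)).abs ?_
    filter_upwards [hlab] with p hp
    rcases hp with h | h <;> rcases hlval p.1 with h' | h' <;> norm_num [h, h']
  have htransfer : ∫ p, l p.1 * sgn (∫ h, ev h p.1 ∂ρ) ∂PT ≤
      ∫ p, p.2 * sgn (∫ h, ev h p.1 ∂ρ) ∂PT + ∫ p, |p.2 - l p.1| ∂PT := by
    rw [← integral_add hi2 hi3]
    refine integral_mono hi1 (hi2.add hi3) fun p => ?_
    have h1 := le_abs_self (p.2 - l p.1)
    have h2 := neg_abs_le (p.2 - l p.1)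
    rcases hBval p.1 with h | h <;> simp only [h] <;> linarith
  linarith
end

section
/- Let X be a measurable space, let H be a measurable space of measurable voters h : X → [-1,1] with measurable evaluation map, let ρ be a probability measure on H, and let P_S be a probability measure on X × {-1,+1} with marginal D_S on X. If the margin μ := E_{h∼ρ} E_{(x_s,y_s)∼P_S}[ y_s h(x_s) ] is strictly positive, then the risk of the ρ-weighted majority vote satisfies R_{P_S}(B_ρ) ≤ 1 − μ² / ( E_{(h,h')∼ρ⊗ρ} E_{x_s∼D_S}[ h(x_s) h'(x_s) ] ). -/
open MeasureTheory

/-- Pointwise Cauchy–Schwarz surrogate: a truncated quadratic in the margin `y * g` is bounded by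
the indicator of correct classification. -/
theorem quadratic_margin_le_correct {y g t : ℝ} (hy : y = 1 ∨ y = -1) (ht : 0 ≤ t) :
    2 * t * (y * g) - t ^ 2 * g ^ 2 ≤ (1 / 2 : ℝ) * (1 + y * sgn g) := by
  unfold sgn
  rcases hy with rfl | rfl <;> split_ifs with hg
  · nlinarith [sq_nonneg (1 - t * g)]
  · nlinarith [sq_nonneg (t * g), mul_nonneg ht (sub_nonneg.2 (not_lt.1 hg))]
  · nlinarith [sq_nonneg (t * g), mul_nonneg ht hg.le]
  · nlinarith [sq_nonneg (1 + t * g)]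

theorem abs_sgn (t : ℝ) : |sgn t| = 1 := by
  unfold sgn
  split_ifs <;> simp

/-- The C-bound of Lacasse et al., as expressed in the MinCq paper (Theorem 2). -/
theorem c_bound
    {X H : Type*} [MeasurableSpace X] [MeasurableSpace H]
    (ev : H → X → ℝ)
    (hev : Measurable (fun p : H × X => ev p.1 p.2))
    (hbd : ∀ h x, ev h x ∈ Set.Icc (-1 : ℝ) 1)
    (ρ : Measure H) [IsProbabilityMeasure ρ]
    (PS : Measure (X × ℝ)) [IsProbabilityMeasure PS]
    (hlab : ∀ᵐ p ∂PS, p.2 = 1 ∨ p.2 = -1)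
    (DS : Measure X) (hDS : DS = PS.map Prod.fst)
    (μ : ℝ) (hμ : μ = ∫ h, ∫ p, p.2 * ev h p.1 ∂PS ∂ρ)
    (hpos : 0 < μ) :
    (1 / 2 : ℝ) * (1 - ∫ p, p.2 * sgn (∫ h, ev h p.1 ∂ρ) ∂PS)
      ≤ 1 - μ ^ 2 /
            (∫ hh : H × H, ∫ x, ev hh.1 x * ev hh.2 x ∂DS ∂(ρ.prod ρ)) := by
  subst hDS
  have hev1 : ∀ h x, |ev h x| ≤ 1 := fun h x => abs_le.2 (hbd h x)
  have hyabs : ∀ᵐ p ∂PS, |p.2| = 1 := by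
    filter_upwards [hlab] with p hp
    rcases hp with hp | hp <;> simp [hp]
  set G : X → ℝ := fun x => ∫ h, ev h x ∂ρ with hG
  have hGm : Measurable G :=
    (hev.stronglyMeasurable.integral_prod_left' (μ := ρ)).measurable
  have hG1 : ∀ x, |G x| ≤ 1 := fun x => by
    simpa using norm_integral_le_of_norm_le_const (μ := ρ) (f := fun h => ev h x) (C := 1)
      (.of_forall fun h => hev1 h x)
  have hμG : μ = ∫ p, p.2 * G p.1 ∂PS := by
    rw [hμ, integral_integral_swap]
    · simp only [integral_const_mul, hG]
    · refine Integrable.of_bound (C := 1) ?_ ?_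
      · exact (measurable_snd.snd.mul
          (hev.comp (measurable_fst.prodMk measurable_snd.fst))).aestronglyMeasurable
      · filter_upwards [Measure.quasiMeasurePreserving_snd.ae hyabs] with q hq
        simpa [Function.uncurry, abs_mul, hq] using hev1 q.1 q.2.1
  have hmap : IsProbabilityMeasure (PS.map Prod.fst) :=
    Measure.isProbabilityMeasure_map measurable_fst.aemeasurable
  have hM : (∫ hh : H × H, ∫ x, ev hh.1 x * ev hh.2 x ∂(PS.map Prod.fst) ∂(ρ.prod ρ))
      = ∫ p, G p.1 ^ 2 ∂PS := by
    rw [integral_integral_swap]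
    · have hprod : ∀ x, ∫ hh : H × H, ev hh.1 x * ev hh.2 x ∂(ρ.prod ρ) = G x * G x := fun x =>
        integral_prod_mul (fun h => ev h x) (fun h => ev h x)
      simp only [hprod]
      rw [integral_map measurable_fst.aemeasurable]
      · simp only [sq]
      · exact (hGm.mul hGm).aestronglyMeasurable
    · refine Integrable.of_bound (C := 1) ?_ (.of_forall fun q => ?_)
      · exact ((hev.comp (measurable_fst.fst.prodMk measurable_snd)).mul
          (hev.comp (measurable_fst.snd.prodMk measurable_snd))).aestronglyMeasurable
      · simpa [Function.uncurry, abs_mul] using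
          mul_le_one₀ (hev1 q.1.1 q.2) (abs_nonneg _) (hev1 q.1.2 q.2)
  rw [hM]
  set M := ∫ p, G p.1 ^ 2 ∂PS
  have hM0 : 0 ≤ M := integral_nonneg fun p => sq_nonneg _
  have hZint : Integrable (fun p : X × ℝ => p.2 * G p.1) PS := by
    refine Integrable.of_bound (C := 1)
      (measurable_snd.mul (hGm.comp measurable_fst)).aestronglyMeasurable ?_
    filter_upwards [hyabs] with p hp
    simpa [abs_mul, hp] using hG1 p.1
  have hGint : Integrable (fun p : X × ℝ => G p.1 ^ 2) PS := by
    refine Integrable.of_bound (C := 1)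
      ((hGm.comp measurable_fst).pow_const 2).aestronglyMeasurable (.of_forall fun p => ?_)
    simpa using hG1 p.1
  have hSint : Integrable (fun p : X × ℝ => p.2 * sgn (G p.1)) PS := by
    refine Integrable.of_bound (C := 1)
      (measurable_snd.mul (measurable_sgn.comp (hGm.comp measurable_fst))).aestronglyMeasurable ?_
    filter_upwards [hyabs] with p hp
    simp [hp, abs_sgn]
  have ht : 0 ≤ μ / M := div_nonneg hpos.le hM0
  have key := integral_mono_ae
    ((hZint.const_mul (2 * (μ / M))).sub (hGint.const_mul ((μ / M) ^ 2)))
    (((integrable_const (1 : ℝ)).add hSint).const_mul (1 / 2))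
    (hlab.mono fun p hp => quadratic_margin_le_correct hp ht)
  simp only [Pi.sub_apply, Pi.add_apply] at key
  rw [integral_sub (hZint.const_mul _) (hGint.const_mul _), integral_const_mul,
    integral_const_mul, integral_const_mul, integral_add (integrable_const _) hSint,
    ← hμG] at key
  have hquot : 2 * (μ / M) * μ - (μ / M) ^ 2 * M = μ ^ 2 / M := by
    rcases eq_or_ne M 0 with h | h
    · simp [h]
    · field_simp
      ring
  simp only [integral_const, probReal_univ, one_smul] at key
  change 2 * (μ / M) * μ - (μ / M) ^ 2 * M ≤ _ at key
  rw [hquot] at key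
  linarith
end

section
/- Let X be a measurable space, let H be a measurable space of measurable voters h : X → {-1,+1} with measurable evaluation map, let ρ be a probability measure on H, and let P_S, P_T be probability measures on X × {-1,+1} with respective marginals D_S, D_T on X. Then the Gibbs risk satisfies R_{P_T}(G_ρ) ≤ R_{P_S}(G_ρ) + dis_ρ(D_S, D_T) + λ_ρ, where dis_ρ(D_S, D_T) := | E_{(h,h')∼ρ⊗ρ}( E_{x_t∼D_T}[ h(x_t) h'(x_t) ] − E_{x_s∼D_S}[ h(x_s) h'(x_s) ] ) | is the domain disagreement, and λ_ρ := | e_{P_T}(ρ) − e_{P_S}(ρ) | with expected joint error e_P(ρ) := E_{(h,h')∼ρ⊗ρ} P_{(x,y)∼P}[ h(x) ≠ y and h'(x) ≠ y ]. -/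
open MeasureTheory

/-- Linearity of the expectation for `1 - a - b + c`. -/
theorem integral_one_sub_sub_add {Ω : Type*} [MeasurableSpace Ω] {μ : Measure Ω}
    [IsProbabilityMeasure μ] {a b c : Ω → ℝ}
    (ha : Integrable a μ) (hb : Integrable b μ) (hc : Integrable c μ) :
    ∫ ω, (1 - a ω - b ω + c ω) ∂μ = 1 - ∫ ω, a ω ∂μ - ∫ ω, b ω ∂μ + ∫ ω, c ω ∂μ := by
  have h1 : Integrable (fun ω => 1 - a ω) μ := (integrable_const _).sub ha
  have h2 : Integrable (fun ω => 1 - a ω - b ω) μ := h1.sub hb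
  rw [integral_add h2 hc, integral_sub h1 hb, integral_sub (integrable_const _) ha]
  simp

/-- The margin of a voter is an integrable function of the voter. -/
theorem integrable_margin {X H : Type*} [MeasurableSpace X] [MeasurableSpace H]
    {ev : H → X → ℝ} (hev : Measurable (fun p : H × X => ev p.1 p.2))
    (hval : ∀ h x, ev h x = 1 ∨ ev h x = -1)
    (ρ : Measure H) [IsProbabilityMeasure ρ]
    (P : Measure (X × ℝ)) [IsProbabilityMeasure P]
    (hlab : ∀ᵐ p ∂P, p.2 = 1 ∨ p.2 = -1) :
    Integrable (fun h => ∫ p, p.2 * ev h p.1 ∂P) ρ := by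
  have hm : Measurable (fun q : H × (X × ℝ) => q.2.2 * ev q.1 q.2.1) :=
    (measurable_snd.comp measurable_snd).mul
      (hev.comp (measurable_fst.prodMk (measurable_fst.comp measurable_snd)))
  refine Integrable.of_bound
    hm.stronglyMeasurable.integral_prod_right'.aestronglyMeasurable 1 (.of_forall fun h => ?_)
  refine (norm_integral_le_of_norm_le_const (C := 1) ?_).trans (by simp)
  filter_upwards [hlab] with p hp
  rcases hp with hp | hp <;> rcases hval h p.1 with h1 | h1 <;> simp [hp, h1]

/-- The agreement of two voters is an integrable function of the pair of voters. -/
theorem integrable_agreement {X H : Type*} [MeasurableSpace X] [MeasurableSpace H]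
    {ev : H → X → ℝ} (hev : Measurable (fun p : H × X => ev p.1 p.2))
    (hval : ∀ h x, ev h x = 1 ∨ ev h x = -1)
    (μ : Measure (H × H)) [IsProbabilityMeasure μ]
    (D : Measure X) [IsProbabilityMeasure D] :
    Integrable (fun hh : H × H => ∫ x, ev hh.1 x * ev hh.2 x ∂D) μ := by
  have hm : Measurable (fun q : (H × H) × X => ev q.1.1 q.2 * ev q.1.2 q.2) :=
    (hev.comp ((measurable_fst.comp measurable_fst).prodMk measurable_snd)).mul
      (hev.comp ((measurable_snd.comp measurable_fst).prodMk measurable_snd))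
  refine Integrable.of_bound
    hm.stronglyMeasurable.integral_prod_right'.aestronglyMeasurable 1 (.of_forall fun hh => ?_)
  refine (norm_integral_le_of_norm_le_const (C := 1) (.of_forall fun x => ?_)).trans (by simp)
  rcases hval hh.1 x with h1 | h1 <;> rcases hval hh.2 x with h2 | h2 <;> simp [h1, h2]

/-- The joint error of two voters in terms of their margins and their agreement. -/
theorem jointError_eq {X : Type*} [MeasurableSpace X] {f g : X → ℝ}
    (hf : Measurable f) (hg : Measurable g)
    (hfv : ∀ x, f x = 1 ∨ f x = -1) (hgv : ∀ x, g x = 1 ∨ g x = -1)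
    (P : Measure (X × ℝ)) [IsProbabilityMeasure P]
    (hlab : ∀ᵐ p ∂P, p.2 = 1 ∨ p.2 = -1) :
    (P {p : X × ℝ | f p.1 ≠ p.2 ∧ g p.1 ≠ p.2}).toReal =
      (1 / 4 : ℝ) * (1 - ∫ p, p.2 * f p.1 ∂P - ∫ p, p.2 * g p.1 ∂P
        + ∫ x, f x * g x ∂(P.map Prod.fst)) := by
  have hf' : Measurable fun p : X × ℝ => f p.1 := hf.comp measurable_fst
  have hg' : Measurable fun p : X × ℝ => g p.1 := hg.comp measurable_fst
  have hs : MeasurableSet {p : X × ℝ | f p.1 ≠ p.2 ∧ g p.1 ≠ p.2} :=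
    (measurableSet_eq_fun hf' measurable_snd).compl.inter
      (measurableSet_eq_fun hg' measurable_snd).compl
  have i1 : Integrable (fun p : X × ℝ => p.2 * f p.1) P := by
    refine Integrable.of_bound (measurable_snd.mul hf').aestronglyMeasurable 1 ?_
    filter_upwards [hlab] with p hp
    rcases hp with hp | hp <;> rcases hfv p.1 with h1 | h1 <;> simp [hp, h1]
  have i2 : Integrable (fun p : X × ℝ => p.2 * g p.1) P := by
    refine Integrable.of_bound (measurable_snd.mul hg').aestronglyMeasurable 1 ?_
    filter_upwards [hlab] with p hp
    rcases hp with hp | hp <;> rcases hgv p.1 with h1 | h1 <;> simp [hp, h1]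
  have i3 : Integrable (fun p : X × ℝ => f p.1 * g p.1) P := by
    refine Integrable.of_bound (hf'.mul hg').aestronglyMeasurable 1 (.of_forall fun p => ?_)
    rcases hfv p.1 with h1 | h1 <;> rcases hgv p.1 with h2 | h2 <;> simp [h1, h2]
  rw [integral_map measurable_fst.aemeasurable (Measurable.aestronglyMeasurable (by fun_prop))]
  have key : ∫ p, (1 / 4 : ℝ) * (1 - p.2 * f p.1 - p.2 * g p.1 + f p.1 * g p.1) ∂P =
      (1 / 4 : ℝ) * (1 - ∫ p, p.2 * f p.1 ∂P - ∫ p, p.2 * g p.1 ∂P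
        + ∫ p, f p.1 * g p.1 ∂P) := by
    rw [integral_const_mul, integral_one_sub_sub_add i1 i2 i3]
  rw [← key, ← Measure.real_def, ← integral_indicator_one hs]
  refine integral_congr_ae ?_
  filter_upwards [hlab] with p hp
  rcases hp with hp | hp <;> rcases hfv p.1 with h1 | h1 <;> rcases hgv p.1 with h2 | h2 <;>
    simp [Set.indicator_apply, hp, h1, h2] <;> norm_num

/-- The Gibbs risk is half the expected disagreement plus the expected joint error. -/
theorem gibbsRisk_eq {X H : Type*} [MeasurableSpace X] [MeasurableSpace H]
    {ev : H → X → ℝ} (hev : Measurable (fun p : H × X => ev p.1 p.2))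
    (hval : ∀ h x, ev h x = 1 ∨ ev h x = -1)
    (ρ : Measure H) [IsProbabilityMeasure ρ]
    (P : Measure (X × ℝ)) [IsProbabilityMeasure P]
    (hlab : ∀ᵐ p ∂P, p.2 = 1 ∨ p.2 = -1) :
    ∫ h, (1 / 2 : ℝ) * (1 - ∫ p, p.2 * ev h p.1 ∂P) ∂ρ =
      (1 / 4 : ℝ) * (1 - ∫ hh : H × H,
        (∫ x, ev hh.1 x * ev hh.2 x ∂(P.map Prod.fst)) ∂(ρ.prod ρ))
      + ∫ hh : H × H,
        (P {p : X × ℝ | ev hh.1 p.1 ≠ p.2 ∧ ev hh.2 p.1 ≠ p.2}).toReal ∂(ρ.prod ρ) := by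
  have : IsProbabilityMeasure (P.map Prod.fst) :=
    Measure.isProbabilityMeasure_map measurable_fst.aemeasurable
  have hmeas : ∀ h, Measurable (ev h) := fun h => hev.comp measurable_prodMk_left
  have im := integrable_margin hev hval ρ P hlab
  have im1 := im.comp_fst ρ
  have im2 := im.comp_snd ρ
  have ic := integrable_agreement hev hval (ρ.prod ρ) (P.map Prod.fst)
  simp_rw [fun hh : H × H => jointError_eq (hmeas hh.1) (hmeas hh.2) (hval hh.1) (hval hh.2)
    P hlab]
  rw [integral_const_mul, integral_const_mul,
    integral_one_sub_sub_add im1 im2 ic,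
    integral_sub (integrable_const _) im,
    integral_fun_fst (fun h => ∫ p, p.2 * ev h p.1 ∂P),
    integral_fun_snd (fun h => ∫ p, p.2 * ev h p.1 ∂P)]
  simp
  ring

/-- The PAC-Bayesian domain adaptation bound (Theorem 1, Germain et al. 2013):
`R_{P_T}(G_ρ) ≤ R_{P_S}(G_ρ) + dis_ρ(D_S, D_T) + λ_ρ`, where `λ_ρ` is the absolute
difference of the expected joint errors on the two domains. -/
theorem pac_bayes_da_bound
    {X H : Type*} [MeasurableSpace X] [MeasurableSpace H]
    (ev : H → X → ℝ)
    (hev : Measurable (fun p : H × X => ev p.1 p.2))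
    (hval : ∀ h x, ev h x = 1 ∨ ev h x = -1)
    (ρ : Measure H) [IsProbabilityMeasure ρ]
    (PS PT : Measure (X × ℝ)) [IsProbabilityMeasure PS] [IsProbabilityMeasure PT]
    (hlabS : ∀ᵐ p ∂PS, p.2 = 1 ∨ p.2 = -1)
    (hlabT : ∀ᵐ p ∂PT, p.2 = 1 ∨ p.2 = -1)
    (DS DT : Measure X) (hDS : DS = PS.map Prod.fst) (hDT : DT = PT.map Prod.fst)
    -- Gibbs risks on the two domains
    (RT RS : ℝ)
    (hRT : RT = ∫ h, (1 / 2 : ℝ) * (1 - ∫ p, p.2 * ev h p.1 ∂PT) ∂ρ)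
    (hRS : RS = ∫ h, (1 / 2 : ℝ) * (1 - ∫ p, p.2 * ev h p.1 ∂PS) ∂ρ)
    -- domain disagreement
    (dis : ℝ)
    (hdis : dis = |∫ hh : H × H,
        ((∫ x, ev hh.1 x * ev hh.2 x ∂DT) - (∫ x, ev hh.1 x * ev hh.2 x ∂DS))
        ∂(ρ.prod ρ)|)
    -- expected joint errors and λ_ρ
    (eT eS lam : ℝ)
    (heT : eT = ∫ hh : H × H,
        (PT {p : X × ℝ | ev hh.1 p.1 ≠ p.2 ∧ ev hh.2 p.1 ≠ p.2}).toReal ∂(ρ.prod ρ))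
    (heS : eS = ∫ hh : H × H,
        (PS {p : X × ℝ | ev hh.1 p.1 ≠ p.2 ∧ ev hh.2 p.1 ≠ p.2}).toReal ∂(ρ.prod ρ))
    (hlam : lam = |eT - eS|) :
    RT ≤ RS + dis + lam := by
  subst hDS hDT
  have : IsProbabilityMeasure (PS.map Prod.fst) :=
    Measure.isProbabilityMeasure_map measurable_fst.aemeasurable
  have : IsProbabilityMeasure (PT.map Prod.fst) :=
    Measure.isProbabilityMeasure_map measurable_fst.aemeasurable
  rw [gibbsRisk_eq hev hval ρ PT hlabT, ← heT] at hRT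
  rw [gibbsRisk_eq hev hval ρ PS hlabS, ← heS] at hRS
  rw [integral_sub (integrable_agreement hev hval _ _) (integrable_agreement hev hval _ _)]
    at hdis
  rw [hRT, hRS, hdis, hlam]
  set cT := ∫ hh : H × H, (∫ x, ev hh.1 x * ev hh.2 x ∂(PT.map Prod.fst)) ∂(ρ.prod ρ)
  set cS := ∫ hh : H × H, (∫ x, ev hh.1 x * ev hh.2 x ∂(PS.map Prod.fst)) ∂(ρ.prod ρ)
  linarith [neg_abs_le (cT - cS), le_abs_self (eT - eS), abs_nonneg (cT - cS)]
end

section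
/- Let X be a measurable space, let H be a measurable space of measurable voters h : X → {-1,+1} with measurable evaluation map, let ρ be a probability measure on H, and let P be a probability measure on X × {-1,+1} with marginal D on X. Then the Gibbs risk decomposes as R_P(G_ρ) = (1/2) d_D(ρ) + e_P(ρ), where d_D(ρ) := E_{(h,h')∼ρ⊗ρ} P_{x∼D}[ h(x) ≠ h'(x) ] is the expected disagreement and e_P(ρ) := E_{(h,h')∼ρ⊗ρ} P_{(x,y)∼P}[ h(x) ≠ y and h'(x) ≠ y ] is the expected joint error. -/
open MeasureTheory

/-- Two binary predictors err with total probability equal to the probability that they disagree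
plus twice the probability that both err. -/
theorem measureReal_ne_label_add {X : Type*} [MeasurableSpace X]
    {f g : X → ℝ} (hf : Measurable f) (hg : Measurable g)
    (hf_val : ∀ x, f x = 1 ∨ f x = -1) (hg_val : ∀ x, g x = 1 ∨ g x = -1)
    (P : Measure (X × ℝ)) [IsFiniteMeasure P] (hlab : ∀ᵐ p ∂P, p.2 = 1 ∨ p.2 = -1) :
    P.real {p | f p.1 ≠ p.2} + P.real {p | g p.1 ≠ p.2} =
      (P.map Prod.fst).real {x | f x ≠ g x} + 2 * P.real {p | f p.1 ≠ p.2 ∧ g p.1 ≠ p.2} := by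
  have hA : MeasurableSet {p : X × ℝ | f p.1 ≠ p.2} :=
    (measurableSet_eq_fun (hf.comp measurable_fst) measurable_snd).compl
  have hB : MeasurableSet {p : X × ℝ | g p.1 ≠ p.2} :=
    (measurableSet_eq_fun (hg.comp measurable_fst) measurable_snd).compl
  have hdisagree : (P.map Prod.fst).real {x | f x ≠ g x} =
      P.real ({p | f p.1 ≠ p.2} \ {p | g p.1 ≠ p.2}) +
        P.real ({p | g p.1 ≠ p.2} \ {p | f p.1 ≠ p.2}) := by
    have hfg : MeasurableSet {x | f x ≠ g x} := (measurableSet_eq_fun hf hg).compl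
    rw [map_measureReal_apply measurable_fst hfg,
      ← measureReal_union disjoint_sdiff_sdiff (hB.diff hA)]
    refine measureReal_congr ?_
    filter_upwards [hlab] with p hp
    refine propext ?_
    change f p.1 ≠ g p.1 ↔
      (f p.1 ≠ p.2 ∧ ¬ g p.1 ≠ p.2) ∨ (g p.1 ≠ p.2 ∧ ¬ f p.1 ≠ p.2)
    rcases hp with hp | hp <;> rcases hf_val p.1 with h₁ | h₁ <;>
      rcases hg_val p.1 with h₂ | h₂ <;> rw [hp, h₁, h₂] <;> norm_num
  have h₁ := measureReal_inter_add_sdiff (μ := P) (s := {p | f p.1 ≠ p.2}) hB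
  have h₂ := measureReal_inter_add_sdiff (μ := P) (s := {p | g p.1 ≠ p.2}) hA
  rw [Set.inter_comm] at h₂
  rw [Set.ofPred_and, hdisagree]
  linarith

/-- The Gibbs risk decomposes as half the expected disagreement plus the expected
joint error: `R_P(G_ρ) = (1/2) d_D(ρ) + e_P(ρ)`. -/
theorem gibbs_risk_decomposition
    {X H : Type*} [MeasurableSpace X] [MeasurableSpace H]
    (ev : H → X → ℝ)
    (hev : Measurable (fun p : H × X => ev p.1 p.2))
    (hval : ∀ h x, ev h x = 1 ∨ ev h x = -1)
    (ρ : Measure H) [IsProbabilityMeasure ρ]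
    (P : Measure (X × ℝ)) [IsProbabilityMeasure P]
    (hlab : ∀ᵐ p ∂P, p.2 = 1 ∨ p.2 = -1)
    (D : Measure X) (hD : D = P.map Prod.fst)
    -- Gibbs risk
    (R : ℝ) (hR : R = ∫ h, (P {p : X × ℝ | ev h p.1 ≠ p.2}).toReal ∂ρ)
    -- expected disagreement
    (d : ℝ)
    (hd : d = ∫ hh : H × H, (D {x : X | ev hh.1 x ≠ ev hh.2 x}).toReal ∂(ρ.prod ρ))
    -- expected joint error
    (e : ℝ)
    (he : e = ∫ hh : H × H,
        (P {p : X × ℝ | ev hh.1 p.1 ≠ p.2 ∧ ev hh.2 p.1 ≠ p.2}).toReal ∂(ρ.prod ρ)) :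
    R = (1 / 2 : ℝ) * d + e := by
  subst hD hR hd he
  have : IsProbabilityMeasure (P.map Prod.fst) :=
    Measure.isProbabilityMeasure_map measurable_fst.aemeasurable
  have hrisk : Integrable (fun h => P.real {p : X × ℝ | ev h p.1 ≠ p.2}) ρ := by
    have hS : MeasurableSet {q : H × (X × ℝ) | ev q.1 q.2.1 ≠ q.2.2} :=
      (measurableSet_eq_fun
        (hev.comp (by fun_prop : Measurable fun q : H × (X × ℝ) => (q.1, q.2.1)))
        (by fun_prop)).compl
    exact Measure.integrable_measure_prodMk_left hS (measure_ne_top _ _)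
  have hfst : Integrable (fun hh : H × H => P.real {p : X × ℝ | ev hh.1 p.1 ≠ p.2}) (ρ.prod ρ) :=
    hrisk.comp_fst ρ
  have hsnd : Integrable (fun hh : H × H => P.real {p : X × ℝ | ev hh.2 p.1 ≠ p.2}) (ρ.prod ρ) :=
    hrisk.comp_snd ρ
  have hdis : Integrable
      (fun hh : H × H => (P.map Prod.fst).real {x | ev hh.1 x ≠ ev hh.2 x}) (ρ.prod ρ) := by
    have hS : MeasurableSet {q : (H × H) × X | ev q.1.1 q.2 ≠ ev q.1.2 q.2} :=
      (measurableSet_eq_fun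
        (hev.comp (by fun_prop : Measurable fun q : (H × H) × X => (q.1.1, q.2)))
        (hev.comp (by fun_prop : Measurable fun q : (H × H) × X => (q.1.2, q.2)))).compl
    exact Measure.integrable_measure_prodMk_left hS (measure_ne_top _ _)
  have hpt (hh : H × H) := measureReal_ne_label_add
    (f := ev hh.1) (g := ev hh.2) (hev.comp measurable_prodMk_left)
    (hev.comp measurable_prodMk_left) (hval _) (hval _) P hlab
  have hjoint : ∀ hh : H × H, P.real {p : X × ℝ | ev hh.1 p.1 ≠ p.2 ∧ ev hh.2 p.1 ≠ p.2} =
      (1 / 2 : ℝ) * (P.real {p : X × ℝ | ev hh.1 p.1 ≠ p.2} +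
        P.real {p : X × ℝ | ev hh.2 p.1 ≠ p.2} -
        (P.map Prod.fst).real {x | ev hh.1 x ≠ ev hh.2 x}) :=
    fun hh => by linarith [hpt hh]
  simp only [← measureReal_def]
  simp_rw [hjoint]
  rw [integral_const_mul, integral_sub (hfst.fun_add hsnd) hdis,
    integral_add hfst hsnd,
    integral_fun_fst (fun h => P.real {p : X × ℝ | ev h p.1 ≠ p.2}),
    integral_fun_snd (fun h => P.real {p : X × ℝ | ev h p.1 ≠ p.2})]
  simp only [probReal_univ, one_smul]
  ring
end
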